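/- arXiv:2306.17668 — 2 statements merged into one kernel-verified Lean document; each statement's English description precedes it below -/
import Mathlib

section
/- Let C be a closed monoidal category and x an object of C. Then the canonical lax module-constraint morphisms δ_{x,y,c} : ihom(x, y) ⊗ c → ihom(x, y ⊗ c) are isomorphisms for all objects y, c of C if and only if x admits a left dual. Moreover, if this is the case, then ihom(x, 1) is a left dual of x, and there is an isomorphism of functors ihom(x, −) ≅ ihom(x, 1) ⊗ (−). -/
open CategoryTheory MonoidalCategory

/-- The canonical lax module-constraint morphism
`δ_{x,y,c} : ihom(x, y) ⊗ c ⟶ ihom(x, y ⊗ c)` of a closed monoidal category: it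
corresponds under the tensor-hom adjunction to
`(ev_{x,y} ▷ c) ∘ α⁻¹ : x ⊗ (ihom(x,y) ⊗ c) ⟶ y ⊗ c`. -/
noncomputable def laxModuleConstraint {C : Type*} [Category C] [MonoidalCategory C]
    [MonoidalClosed C] (x y c : C) : (ihom x).obj y ⊗ c ⟶ (ihom x).obj (y ⊗ c) :=
  MonoidalClosed.curry ((α_ x ((ihom x).obj y) c).inv ≫ ((ihom.ev x).app y ▷ c))

/-- One triangle identity implies the other one after pairing both of its sides with `e`. -/
lemma whiskerLeft_zigzag_comp {C : Type*} [Category C] [MonoidalCategory C] {x d : C}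
    (η : 𝟙_ C ⟶ d ⊗ x) (e : x ⊗ d ⟶ 𝟙_ C)
    (triangle : x ◁ η ≫ (α_ x d x).inv ≫ e ▷ x = (ρ_ x).hom ≫ (λ_ x).inv) :
    x ◁ (η ▷ d ≫ (α_ d x d).hom ≫ d ◁ e) ≫ (α_ x d (𝟙_ C)).inv ≫ e ▷ 𝟙_ C =
      x ◁ ((λ_ d).hom ≫ (ρ_ d).inv) ≫ (α_ x d (𝟙_ C)).inv ≫ e ▷ 𝟙_ C := by
  calc
    _ = 𝟙 _ ⊗≫ x ◁ η ▷ d ⊗≫ ((x ⊗ d) ◁ e ≫ e ▷ 𝟙_ C) ⊗≫ 𝟙 _ := by monoidal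
    _ = 𝟙 _ ⊗≫ (x ◁ η ≫ (α_ _ _ _).inv ≫ e ▷ x) ▷ d ⊗≫ 𝟙_ C ◁ e ⊗≫ 𝟙 _ := by
      rw [whisker_exchange]; monoidal
    _ = 𝟙 _ ⊗≫ (𝟙_ C ◁ e) ⊗≫ 𝟙 _ := by rw [triangle]; monoidal
    _ = _ := by monoidal

section

open MonoidalClosed ExactPairing

variable {C : Type*} [Category C] [MonoidalCategory C] [MonoidalClosed C]

lemma uncurry_comp_laxModuleConstraint {x y c z : C} (f : z ⟶ (ihom x).obj y ⊗ c) :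
    uncurry (f ≫ laxModuleConstraint x y c) =
      x ◁ f ≫ (α_ x ((ihom x).obj y) c).inv ≫ (ihom.ev x).app y ▷ c := by
  rw [uncurry_natural_left, laxModuleConstraint, uncurry_curry]

/-- If the lax module-constraint morphisms `ihom(x, 𝟙) ⊗ x ⟶ ihom(x, 𝟙 ⊗ x)` and
`ihom(x, 𝟙) ⊗ 𝟙 ⟶ ihom(x, 𝟙 ⊗ 𝟙)` are invertible, then evaluation exhibits `ihom(x, 𝟙)` as
a left dual of `x`. -/
noncomputable abbrev exactPairingOfIsIsoLaxModuleConstraint (x : C)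
    [IsIso (laxModuleConstraint x (𝟙_ C) x)] [IsIso (laxModuleConstraint x (𝟙_ C) (𝟙_ C))] :
    ExactPairing ((ihom x).obj (𝟙_ C)) x :=
  let η := curry ((ρ_ x).hom ≫ (λ_ x).inv) ≫ inv (laxModuleConstraint x (𝟙_ C) x)
  have triangle : x ◁ η ≫ (α_ _ _ _).inv ≫ (ihom.ev x).app (𝟙_ C) ▷ x =
      (ρ_ x).hom ≫ (λ_ x).inv := by
    rw [← uncurry_comp_laxModuleConstraint]
    simp [η]
  { coevaluation' := η
    evaluation' := (ihom.ev x).app (𝟙_ C)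
    coevaluation_evaluation' := triangle
    evaluation_coevaluation' := by
      rw [← cancel_mono (laxModuleConstraint x (𝟙_ C) (𝟙_ C))]
      apply uncurry_injective
      rw [uncurry_comp_laxModuleConstraint, uncurry_comp_laxModuleConstraint]
      exact whiskerLeft_zigzag_comp η _ triangle }

/-- The internal hom out of an object with a left dual is tensoring with the left dual. -/
noncomputable def ihomIsoTensorLeft (d x : C) [ExactPairing d x] : ihom x ≅ tensorLeft d :=
  (ihom.adjunction x).rightAdjointUniq (tensorLeftAdjunction d x)

lemma uncurry_ihomIsoTensorLeft_inv_app (d x y : C) [ExactPairing d x] :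
    uncurry ((ihomIsoTensorLeft d x).inv.app y) =
      (α_ x d y).inv ≫ ε_ d x ▷ y ≫ (λ_ y).hom := by
  have h := Adjunction.rightAdjointUniq_hom_app_counit
    (tensorLeftAdjunction d x) (ihom.adjunction x) y
  refine h.trans ?_
  change x ◁ 𝟙 _ ≫ _ = _
  simp

lemma ihomIsoTensorLeft_inv_app_whiskerRight_comp_laxModuleConstraint (d x y c : C)
    [ExactPairing d x] :
    (ihomIsoTensorLeft d x).inv.app y ▷ c ≫ laxModuleConstraint x y c =
      (α_ d y c).hom ≫ (ihomIsoTensorLeft d x).inv.app (y ⊗ c) := by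
  have h := uncurry_ihomIsoTensorLeft_inv_app d x y
  rw [uncurry_eq] at h
  apply uncurry_injective
  rw [uncurry_comp_laxModuleConstraint, uncurry_natural_left, uncurry_ihomIsoTensorLeft_inv_app,
    associator_inv_naturality_middle_assoc, ← comp_whiskerRight]
  refine (congrArg (fun t => (α_ x (d ⊗ y) c).inv ≫ t ▷ c) h).trans ?_
  monoidal

lemma isIso_laxModuleConstraint (d x y c : C) [ExactPairing d x] :
    IsIso (laxModuleConstraint x y c) := by
  have h := ihomIsoTensorLeft_inv_app_whiskerRight_comp_laxModuleConstraint d x y c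
  have : IsIso ((ihomIsoTensorLeft d x).inv.app y ▷ c ≫ laxModuleConstraint x y c) := by
    rw [h]
    infer_instance
  exact IsIso.of_isIso_comp_left ((ihomIsoTensorLeft d x).inv.app y ▷ c) _

end

/-- STATEMENT 8: in a closed monoidal category, the lax module-constraint morphisms
`δ_{x,y,c} : ihom(x, y) ⊗ c ⟶ ihom(x, y ⊗ c)` are isomorphisms for all `y, c` if and
only if `x` admits a left dual; moreover, in that case `ihom(x, 𝟙)` is a left dual of `x`
and `ihom(x, −) ≅ ihom(x, 𝟙) ⊗ (−)`. -/
theorem laxModuleConstraint_isIso_iff_hasLeftDual {C : Type*} [Category C]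
    [MonoidalCategory C] [MonoidalClosed C] (x : C) :
    ((∀ y c : C, IsIso (laxModuleConstraint x y c)) ↔ Nonempty (HasLeftDual x)) ∧
    ((∀ y c : C, IsIso (laxModuleConstraint x y c)) →
      Nonempty (ExactPairing ((ihom x).obj (𝟙_ C)) x) ∧
      Nonempty (ihom x ≅ tensorLeft ((ihom x).obj (𝟙_ C)))) := by
  have pairing (h : ∀ y c : C, IsIso (laxModuleConstraint x y c)) :
      Nonempty (ExactPairing ((ihom x).obj (𝟙_ C)) x) :=
    have := h (𝟙_ C)
    ⟨exactPairingOfIsIsoLaxModuleConstraint x⟩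
  refine ⟨⟨fun h => ?_, fun ⟨_⟩ y c => isIso_laxModuleConstraint (HasLeftDual.leftDual x) x y c⟩,
    fun h => ⟨pairing h, ?_⟩⟩
  · obtain ⟨_⟩ := pairing h
    exact ⟨⟨(ihom x).obj (𝟙_ C)⟩⟩
  · obtain ⟨_⟩ := pairing h
    exact ⟨ihomIsoTensorLeft _ x⟩
end

section
/- Let C be a closed monoidal category. The full subcategory of C on those objects x for which all the canonical lax module-constraint morphisms δ_{x,y,c} : ihom(x, y) ⊗ c → ihom(x, y ⊗ c) are isomorphisms is a unital monoidal subcategory: the monoidal unit 1 belongs to it, and if x and x' both belong to it, then so does x ⊗ x'. -/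
open CategoryTheory MonoidalCategory

section

open MonoidalClosed

variable {C : Type*} [Category C] [MonoidalCategory C] [MonoidalClosed C]

/-- Composing with `curry g` and then evaluating amounts to applying `g`. -/
lemma whiskerLeft_comp_curry_ev {x y z w : C} (f : w ⟶ z) (g : x ⊗ z ⟶ y) :
    x ◁ (f ≫ curry g) ≫ (ihom.ev x).app y = x ◁ f ≫ g := by
  rw [MonoidalCategory.whiskerLeft_comp, Category.assoc, whiskerLeft_curry_ihom_ev_app]

/-- The transpose of `δ_{x,y,c}` precomposed with a morphism `curry g ▷ c`. -/
lemma curry_whiskerRight_laxModuleConstraint {x y z : C} (g : x ⊗ z ⟶ y) (c : C) :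
    curry g ▷ c ≫ laxModuleConstraint x y c = curry ((α_ x z c).inv ≫ g ▷ c) := by
  rw [laxModuleConstraint, ← curry_natural_left, associator_inv_naturality_middle_assoc,
    ← comp_whiskerRight, whiskerLeft_curry_ihom_ev_app]

instance isIso_curry_leftUnitor_hom (y : C) : IsIso (curry (λ_ y).hom) := by
  refine ⟨(λ_ _).inv ≫ (ihom.ev (𝟙_ C)).app y, ?_, ?_⟩
  · rw [leftUnitor_inv_naturality_assoc, whiskerLeft_curry_ihom_ev_app, Iso.inv_hom_id]
  · apply uncurry_injective
    rw [uncurry_natural_left, uncurry_curry, uncurry_id_eq_ev, leftUnitor_naturality,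
      Iso.hom_inv_id_assoc]

lemma isIso_laxModuleConstraint_unit (y c : C) : IsIso (laxModuleConstraint (𝟙_ C) y c) := by
  have h : curry (λ_ y).hom ▷ c ≫ laxModuleConstraint (𝟙_ C) y c = curry (λ_ (y ⊗ c)).hom := by
    rw [curry_whiskerRight_laxModuleConstraint, leftUnitor_tensor_hom]
  have : IsIso (curry (λ_ y).hom ▷ c ≫ laxModuleConstraint (𝟙_ C) y c) := h ▸ inferInstance
  exact IsIso.of_isIso_comp_left (curry (λ_ y).hom ▷ c) _

/-- The morphism `(x ⊗ x') ⊗ ihom(x', ihom(x, y)) ⟶ y` evaluating twice. -/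
noncomputable def evTensor (x x' y : C) :
    (x ⊗ x') ⊗ (ihom x').obj ((ihom x).obj y) ⟶ y :=
  (α_ x x' _).hom ≫ x ◁ (ihom.ev x').app ((ihom x).obj y) ≫ (ihom.ev x).app y

instance isIso_curry_evTensor (x x' y : C) : IsIso (curry (evTensor x x' y)) := by
  refine ⟨curry (curry ((α_ x x' _).inv ≫ (ihom.ev (x ⊗ x')).app y)), ?_, ?_⟩
  · apply uncurry_injective
    apply uncurry_injective
    rw [uncurry_natural_left, uncurry_curry, uncurry_natural_left, uncurry_curry,
      associator_inv_naturality_right_assoc, whiskerLeft_curry_ihom_ev_app, evTensor,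
      Iso.inv_hom_id_assoc, uncurry_id_eq_ev, uncurry_eq]
  · apply uncurry_injective
    rw [uncurry_natural_left, uncurry_curry, evTensor, associator_naturality_right_assoc,
      ← whiskerLeft_comp_assoc, whiskerLeft_curry_ihom_ev_app, whiskerLeft_curry_ihom_ev_app,
      Iso.hom_inv_id_assoc, uncurry_id_eq_ev]

/-- Under `ihom(x ⊗ x', -) ≅ ihom(x', ihom(x, -))`, the constraint `δ_{x ⊗ x',y,c}` is the
composite of `δ_{x',ihom(x,y),c}` and `ihom(x', δ_{x,y,c})`. -/
lemma curry_evTensor_whiskerRight_laxModuleConstraint (x x' y c : C) :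
    curry (evTensor x x' y) ▷ c ≫ laxModuleConstraint (x ⊗ x') y c =
      laxModuleConstraint x' ((ihom x).obj y) c ≫
        (ihom x').map (laxModuleConstraint x y c) ≫ curry (evTensor x x' (y ⊗ c)) := by
  rw [curry_whiskerRight_laxModuleConstraint, laxModuleConstraint, ← curry_natural_right_assoc,
    ← curry_natural_left]
  congr 1
  rw [evTensor, evTensor, associator_naturality_right_assoc, ← whiskerLeft_comp_assoc,
    whiskerLeft_curry_ihom_ev_app, laxModuleConstraint, whiskerLeft_comp_curry_ev]
  simp

lemma isIso_laxModuleConstraint_tensor (x x' y c : C) [IsIso (laxModuleConstraint x y c)]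
    [IsIso (laxModuleConstraint x' ((ihom x).obj y) c)] :
    IsIso (laxModuleConstraint (x ⊗ x') y c) := by
  have : IsIso (curry (evTensor x x' y) ▷ c ≫ laxModuleConstraint (x ⊗ x') y c) := by
    rw [curry_evTensor_whiskerRight_laxModuleConstraint]
    infer_instance
  exact IsIso.of_isIso_comp_left (curry (evTensor x x' y) ▷ c) _

end

/-- STATEMENT 9: in a closed monoidal category, the objects `x` for which all the
lax module-constraint morphisms `δ_{x,y,c}` are isomorphisms form a unital monoidal
subcategory: the monoidal unit is such an object, and the class of such objects is closed
under the tensor product. -/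
theorem laxModuleConstraint_isIso_monoidal_subcategory {C : Type*} [Category C]
    [MonoidalCategory C] [MonoidalClosed C] :
    (∀ y c : C, IsIso (laxModuleConstraint (𝟙_ C) y c)) ∧
    (∀ x x' : C, (∀ y c : C, IsIso (laxModuleConstraint x y c)) →
      (∀ y c : C, IsIso (laxModuleConstraint x' y c)) →
      (∀ y c : C, IsIso (laxModuleConstraint (x ⊗ x') y c))) :=
  ⟨isIso_laxModuleConstraint_unit, fun x x' _ _ y c => isIso_laxModuleConstraint_tensor x x' y c⟩
end
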